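/- arXiv:1511.09343 — 3 statements merged into one kernel-verified Lean document; each statement's English description precedes it below -/
import Mathlib

section
/- Let (v₁,v₂,λ₁,λ₂) be a nontrivial solution of the one-dimensional system with viscosity ν. Then there exists k ∈ ℕ such that, for each i ∈ {1,2}, v_i has exactly k critical points in the open interval (0,1) (points where v_i' vanishes), all of which are non-degenerate (v_i'' ≠ 0 there), and exactly k+1 points in (0,1) at which v_i'' vanishes, each of which is isolated. -/
open Set Filter MeasureTheory

/-- Assumptions on the interaction functions `g`: `C²` on `[0,∞)`, strictly
increasing there, and `Cg⁻¹ s ≤ g s ≤ Cg s` for all `s ≥ 0`. -/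
def GAss (Cg : ℝ) (g : ℝ → ℝ) : Prop :=
  ContDiffOn ℝ 2 g (Set.Ici 0) ∧ StrictMonoOn g (Set.Ici 0) ∧
    ∀ s : ℝ, 0 ≤ s → Cg⁻¹ * s ≤ g s ∧ g s ≤ Cg * s

/-- A solution of the one-dimensional system with viscosity `ν`:
`v₁, v₂` twice continuously differentiable, satisfying the ODEs on `[0,1]`,
positive on `[0,1]`, with Neumann boundary conditions and unit `L²` mass. -/
def IsSolution (ν : ℝ) (g₁ g₂ v₁ v₂ : ℝ → ℝ) (l₁ l₂ : ℝ) : Prop :=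
  ContDiff ℝ 2 v₁ ∧ ContDiff ℝ 2 v₂ ∧
    (∀ x ∈ Set.Icc (0:ℝ) 1,
      -ν * deriv (deriv v₁) x + g₁ ((v₂ x) ^ 2) * v₁ x = l₁ * v₁ x) ∧
    (∀ x ∈ Set.Icc (0:ℝ) 1,
      -ν * deriv (deriv v₂) x + g₂ ((v₁ x) ^ 2) * v₂ x = l₂ * v₂ x) ∧
    (∀ x ∈ Set.Icc (0:ℝ) 1, 0 < v₁ x) ∧
    (∀ x ∈ Set.Icc (0:ℝ) 1, 0 < v₂ x) ∧
    deriv v₁ 0 = 0 ∧ deriv v₁ 1 = 0 ∧ deriv v₂ 0 = 0 ∧ deriv v₂ 1 = 0 ∧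
    (∫ x in (0:ℝ)..1, (v₁ x) ^ 2) = 1 ∧ (∫ x in (0:ℝ)..1, (v₂ x) ^ 2) = 1

/-- The trivial (constant) solution: `v₁ ≡ v₂ ≡ 1` on `[0,1]`. -/
def IsTrivialSol (v₁ v₂ : ℝ → ℝ) : Prop :=
  ∀ x ∈ Set.Icc (0:ℝ) 1, v₁ x = 1 ∧ v₂ x = 1

open Topology in
lemma aux_rolle_freq (f : ℝ → ℝ) (hf : Continuous f) (hf' : Continuous (deriv f)) (c x0 : ℝ)
    (hx0 : x0 ∈ Icc (0:ℝ) 1)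
    (h : ∃ᶠ z in 𝓝[≠] x0, z ∈ Icc (0:ℝ) 1 ∧ f z = c) :
    f x0 = c ∧ deriv f x0 = 0 ∧ ∃ᶠ z in 𝓝[≠] x0, z ∈ Icc (0:ℝ) 1 ∧ deriv f z = 0 := by
  have key : ∀ (φ : ℝ → ℝ) (d : ℝ), Continuous φ →
      (∃ᶠ z in 𝓝[≠] x0, z ∈ Icc (0:ℝ) 1 ∧ φ z = d) → φ x0 = d := by
    intro φ d hφ hfr
    by_contra hne
    have : ∀ᶠ z in 𝓝[≠] x0, φ z ≠ d :=
      (hφ.continuousAt.eventually_ne hne).filter_mono nhdsWithin_le_nhds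
    obtain ⟨z, hz1, hz2⟩ := (hfr.and_eventually this).exists
    exact hz2 hz1.2
  have h0 := key f c hf h
  have h2 : ∃ᶠ z in 𝓝[≠] x0, z ∈ Icc (0:ℝ) 1 ∧ deriv f z = 0 := by
    rw [frequently_nhdsWithin_iff, Metric.nhds_basis_ball.frequently_iff]
    rw [frequently_nhdsWithin_iff, Metric.nhds_basis_ball.frequently_iff] at h
    intro ε hε
    obtain ⟨z, hz, ⟨hzI, hfz⟩, hne⟩ := h ε hε
    rw [Metric.mem_ball, Real.dist_eq, abs_lt] at hz
    rcases lt_or_gt_of_ne (show z ≠ x0 from hne) with hlt | hlt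
    · obtain ⟨y, hy, hdy⟩ := exists_deriv_eq_zero hlt hf.continuousOn (hfz.trans h0.symm)
      refine ⟨y, ?_, ⟨⟨by linarith [hzI.1, hy.1], by linarith [hx0.2, hy.2]⟩, hdy⟩, hy.2.ne⟩
      rw [Metric.mem_ball, Real.dist_eq, abs_lt]
      constructor <;> linarith [hy.1, hy.2, hz.1, hz.2]
    · obtain ⟨y, hy, hdy⟩ := exists_deriv_eq_zero hlt hf.continuousOn (h0.trans hfz.symm)
      refine ⟨y, ?_, ⟨⟨by linarith [hx0.1, hy.1], by linarith [hzI.2, hy.2]⟩, hdy⟩, hy.1.ne'⟩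
      rw [Metric.mem_ball, Real.dist_eq, abs_lt]
      constructor <;> linarith [hy.1, hy.2, hz.1, hz.2]
  exact ⟨h0, key _ 0 hf' h2, h2⟩

lemma aux_energy (E E' : ℝ → ℝ) (C x0 : ℝ) (hE : ∀ x, HasDerivAt E (E' x) x)
    (hb : ∀ x ∈ Icc (0:ℝ) 1, |E' x| ≤ C * E x) (hx0 : x0 ∈ Icc (0:ℝ) 1) (h0 : E x0 = 0) :
    ∀ x ∈ Icc (0:ℝ) 1, E x ≤ 0 := by
  have hd : ∀ D x, HasDerivAt (fun y => E y * Real.exp (D * y))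
      ((E' x + D * E x) * Real.exp (D * x)) x := by
    intro D x
    have h1 : HasDerivAt (fun y => Real.exp (D * y)) (Real.exp (D * x) * (D * 1)) x :=
      ((hasDerivAt_id x).const_mul D).exp
    refine HasDerivAt.congr_deriv ((hE x).mul h1) ?_
    ring
  have hcont : ∀ D, Continuous (fun y => E y * Real.exp (D * y)) := fun D =>
    continuous_iff_continuousAt.2 fun x => (hd D x).continuousAt
  intro x hx
  rcases le_total x0 x with hle | hle
  · have : AntitoneOn (fun y => E y * Real.exp (-C * y)) (Icc 0 1) := by
      apply antitoneOn_of_deriv_nonpos (convex_Icc 0 1) (hcont _).continuousOn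
        (fun y _ => (hd _ y).differentiableAt.differentiableWithinAt)
      intro y hy
      rw [(hd _ y).deriv]
      have := (abs_le.1 (hb y (interior_subset hy))).2
      exact mul_nonpos_of_nonpos_of_nonneg (by linarith) (Real.exp_pos _).le
    have := this hx0 hx hle
    simp only [h0, zero_mul] at this
    exact nonpos_of_mul_nonpos_left this (Real.exp_pos _)
  · have : MonotoneOn (fun y => E y * Real.exp (C * y)) (Icc 0 1) := by
      apply monotoneOn_of_deriv_nonneg (convex_Icc 0 1) (hcont _).continuousOn
        (fun y _ => (hd _ y).differentiableAt.differentiableWithinAt)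
      intro y hy
      rw [(hd _ y).deriv]
      have := (abs_le.1 (hb y (interior_subset hy))).1
      exact mul_nonneg (by linarith) (Real.exp_pos _).le
    have := this hx hx0 hle
    simp only [h0, zero_mul] at this
    exact nonpos_of_mul_nonpos_left this (Real.exp_pos _)

lemma aux_lip (ν Cg l : ℝ) (g v w : ℝ → ℝ) (hν : 0 < ν) (hg : GAss Cg g)
    (hv : Continuous v) (hw : Continuous w)
    (heq : ∀ x ∈ Icc (0:ℝ) 1, -ν * deriv (deriv v) x + g ((w x) ^ 2) * v x = l * v x)
    (hvp : ∀ x ∈ Icc (0:ℝ) 1, 0 < v x) (x0 : ℝ) (hx0 : x0 ∈ Icc (0:ℝ) 1)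
    (h0 : deriv (deriv v) x0 = 0) :
    ∃ K : ℝ, 0 ≤ K ∧ ∀ x ∈ Icc (0:ℝ) 1, |deriv (deriv v) x| ≤ K * |w x - w x0| := by
  obtain ⟨V, hV⟩ := isCompact_Icc.exists_bound_of_continuousOn (s := Icc (0:ℝ) 1) hv.continuousOn
  obtain ⟨W, hW⟩ := isCompact_Icc.exists_bound_of_continuousOn (s := Icc (0:ℝ) 1) hw.continuousOn
  simp only [Real.norm_eq_abs] at hV hW
  have hV0 : 0 ≤ V := (abs_nonneg _).trans (hV x0 hx0)
  have hW0 : 0 ≤ W := (abs_nonneg _).trans (hW x0 hx0)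
  obtain ⟨L, hL⟩ := (hg.1.mono (show Icc 0 (W ^ 2) ⊆ Ici 0 from Icc_subset_Ici_self)).exists_lipschitzOnWith
    (by norm_num) (convex_Icc 0 (W ^ 2)) isCompact_Icc
  have hmem : ∀ x ∈ Icc (0:ℝ) 1, w x ^ 2 ∈ Icc 0 (W ^ 2) := fun x hx =>
    ⟨sq_nonneg _, by rw [← sq_abs (w x)]; exact pow_le_pow_left₀ (abs_nonneg _) (hW x hx) 2⟩
  have hl : g (w x0 ^ 2) = l := by
    have := heq x0 hx0
    rw [h0, mul_zero, zero_add] at this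
    exact mul_right_cancel₀ (hvp x0 hx0).ne' this
  refine ⟨ν⁻¹ * (L * (2 * W) * V), by positivity, fun x hx => ?_⟩
  have h1 : deriv (deriv v) x = ν⁻¹ * ((g (w x ^ 2) - g (w x0 ^ 2)) * v x) := by
    have := heq x hx
    rw [hl]
    field_simp
    linarith
  have h2 := hL.dist_le_mul _ (hmem x hx) _ (hmem x0 hx0)
  rw [Real.dist_eq, Real.dist_eq] at h2
  have h3 : |w x ^ 2 - w x0 ^ 2| ≤ 2 * W * |w x - w x0| := by
    rw [sq_sub_sq, abs_mul]
    apply mul_le_mul_of_nonneg_right _ (abs_nonneg _)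
    have := abs_add_le (w x) (w x0)
    linarith [hW x hx, hW x0 hx0]
  rw [h1, abs_mul, abs_mul, abs_of_pos (inv_pos.2 hν), mul_assoc]
  apply mul_le_mul_of_nonneg_left _ (inv_pos.2 hν).le
  calc |g (w x ^ 2) - g (w x0 ^ 2)| * |v x| ≤ (L * (2 * W * |w x - w x0|)) * V := by
        apply mul_le_mul _ (hV x hx) (abs_nonneg _) (by positivity)
        exact h2.trans (mul_le_mul_of_nonneg_left h3 L.2)
    _ = _ := by ring

lemma aux_inj (ν Cg l : ℝ) (g v w : ℝ → ℝ) (hg : GAss Cg g)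
    (heq : ∀ x ∈ Icc (0:ℝ) 1, -ν * deriv (deriv v) x + g ((w x) ^ 2) * v x = l * v x)
    (hvp : ∀ x ∈ Icc (0:ℝ) 1, 0 < v x) (hwp : ∀ x ∈ Icc (0:ℝ) 1, 0 < w x) (x y : ℝ)
    (hx : x ∈ Icc (0:ℝ) 1) (hy : y ∈ Icc (0:ℝ) 1)
    (h0 : deriv (deriv v) x = 0) (h1 : deriv (deriv v) y = 0) : w x = w y := by
  have hl : ∀ z ∈ Icc (0:ℝ) 1, deriv (deriv v) z = 0 → g (w z ^ 2) = l := by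
    intro z hz h0
    have := heq z hz
    rw [h0, mul_zero, zero_add] at this
    exact mul_right_cancel₀ (hvp z hz).ne' this
  have := hg.2.1.injOn (mem_Ici.2 (sq_nonneg _)) (mem_Ici.2 (sq_nonneg _)) ((hl x hx h0).trans (hl y hy h1).symm)
  exact (pow_left_inj₀ (hwp x hx).le (hwp y hy).le two_ne_zero).1 this

lemma aux_symm {ν : ℝ} {g₁ g₂ v₁ v₂ : ℝ → ℝ} {l₁ l₂ : ℝ} (h : IsSolution ν g₁ g₂ v₁ v₂ l₁ l₂) :
    IsSolution ν g₂ g₁ v₂ v₁ l₂ l₁ := by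
  obtain ⟨a, b, c, d, e, f, g, h, i, j, k, l⟩ := h
  exact ⟨b, a, d, c, f, e, i, j, g, h, l, k⟩

lemma aux_one (v : ℝ → ℝ) (a : ℝ) (hp : ∀ x ∈ Icc (0:ℝ) 1, 0 < v x)
    (h : ∀ x ∈ Icc (0:ℝ) 1, v x = a) (hi : (∫ x in (0:ℝ)..1, (v x) ^ 2) = 1) : a = 1 := by
  have : (∫ x in (0:ℝ)..1, (v x) ^ 2) = ∫ x in (0:ℝ)..1, a ^ 2 := by
    apply intervalIntegral.integral_congr
    intro x hx
    rw [uIcc_of_le zero_le_one] at hx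
    simp only [h x hx]
  rw [this] at hi
  simp at hi
  have h0 := hp 0 (by simp)
  rw [h 0 (by simp)] at h0
  rcases hi with h | h <;> linarith

open Topology in
lemma aux_finite (ν Cg l₁ l₂ : ℝ) (g₁ g₂ v₁ v₂ : ℝ → ℝ)
    (hν : 0 < ν) (hg₁ : GAss Cg g₁) (hg₂ : GAss Cg g₂)
    (hsol : IsSolution ν g₁ g₂ v₁ v₂ l₁ l₂)
    (hnt : ¬ IsTrivialSol v₁ v₂) : {x ∈ Ioo (0:ℝ) 1 | deriv v₁ x = 0}.Finite := by
  by_contra hinf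
  apply hnt
  obtain ⟨c1, c2, e1, e2, p1, p2, -, -, -, -, i1, i2⟩ := hsol
  have c1' : ContDiff ℝ 1 (deriv v₁) := ((contDiff_succ_iff_deriv (n := 1)).1 c1).2.2
  have c2' : ContDiff ℝ 1 (deriv v₂) := ((contDiff_succ_iff_deriv (n := 1)).1 c2).2.2
  have k1 : Continuous (deriv (deriv v₁)) := c1'.continuous_deriv le_rfl
  have k2 : Continuous (deriv (deriv v₂)) := c2'.continuous_deriv le_rfl
  obtain ⟨x0, hx0, hacc⟩ := Set.Infinite.exists_accPt_of_subset_isCompact (K := Icc (0:ℝ) 1)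
    hinf isCompact_Icc (fun x hx => Ioo_subset_Icc_self hx.1)
  rw [accPt_iff_frequently_nhdsNE] at hacc
  obtain ⟨a1, a2, f1⟩ := aux_rolle_freq (deriv v₁) c1'.continuous k1 0 x0 hx0
    (hacc.mono fun z hz => ⟨Ioo_subset_Icc_self hz.1, hz.2⟩)
  obtain ⟨-, b1, f2⟩ := aux_rolle_freq v₂ c2.continuous c2'.continuous (v₂ x0) x0 hx0
    (f1.mono fun z hz => ⟨hz.1, aux_inj ν Cg l₁ g₁ v₁ v₂ hg₁ e1 p1 p2 z x0 hz.1 hx0 hz.2 a2⟩)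
  obtain ⟨-, b2, -⟩ := aux_rolle_freq (deriv v₂) c2'.continuous k2 0 x0 hx0 f2
  obtain ⟨K1, hK1, L1⟩ := aux_lip ν Cg l₁ g₁ v₁ v₂ hν hg₁ c1.continuous c2.continuous e1 p1 x0 hx0 a2
  obtain ⟨K2, hK2, L2⟩ := aux_lip ν Cg l₂ g₂ v₂ v₁ hν hg₂ c2.continuous c1.continuous e2 p2 x0 hx0 b2
  have d1 : ∀ x, HasDerivAt v₁ (deriv v₁ x) x := fun x =>
    (c1.differentiable (by norm_num) x).hasDerivAt
  have d2 : ∀ x, HasDerivAt v₂ (deriv v₂ x) x := fun x =>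
    (c2.differentiable (by norm_num) x).hasDerivAt
  have d1' : ∀ x, HasDerivAt (deriv v₁) (deriv (deriv v₁) x) x := fun x =>
    (c1'.differentiable (by norm_num) x).hasDerivAt
  have d2' : ∀ x, HasDerivAt (deriv v₂) (deriv (deriv v₂) x) x := fun x =>
    (c2'.differentiable (by norm_num) x).hasDerivAt
  have hE := aux_energy
    (fun x => (v₁ x - v₁ x0) ^ 2 + deriv v₁ x ^ 2 + (v₂ x - v₂ x0) ^ 2 + deriv v₂ x ^ 2)
    (fun x => 2 * (v₁ x - v₁ x0) * deriv v₁ x + 2 * deriv v₁ x * deriv (deriv v₁) x +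
      2 * (v₂ x - v₂ x0) * deriv v₂ x + 2 * deriv v₂ x * deriv (deriv v₂) x)
    (1 + K1 + K2) x0
    (by
      intro x
      refine HasDerivAt.congr_deriv ((((((d1 x).sub_const (v₁ x0)).pow 2).add ((d1' x).pow 2)).add
        (((d2 x).sub_const (v₂ x0)).pow 2)).add ((d2' x).pow 2)) ?_
      simp)
    (by
      intro x hx
      have q : ∀ K s t r : ℝ, 0 ≤ K → |t| ≤ K * |r| → |2 * s * t| ≤ K * (s ^ 2 + r ^ 2) := by
        intro K s t r hK h
        rw [abs_mul, abs_mul, abs_two]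
        have h1 := mul_le_mul_of_nonneg_left h (abs_nonneg s)
        have h2 := mul_nonneg hK (sq_nonneg (|s| - |r|))
        rw [← sq_abs s, ← sq_abs r]
        nlinarith
      have q1 := q 1 (v₁ x - v₁ x0) (deriv v₁ x) (deriv v₁ x) zero_le_one (by simp)
      have q2 := q 1 (v₂ x - v₂ x0) (deriv v₂ x) (deriv v₂ x) zero_le_one (by simp)
      have q3 := q K1 (deriv v₁ x) _ _ hK1 (L1 x hx)
      have q4 := q K2 (deriv v₂ x) _ _ hK2 (L2 x hx)
      have s1 := mul_nonneg hK1 (sq_nonneg (v₁ x - v₁ x0))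
      have s2 := mul_nonneg hK1 (sq_nonneg (deriv v₂ x))
      have s3 := mul_nonneg hK2 (sq_nonneg (v₂ x - v₂ x0))
      have s4 := mul_nonneg hK2 (sq_nonneg (deriv v₁ x))
      rw [abs_le] at q1 q2 q3 q4 ⊢
      obtain ⟨q11, q12⟩ := q1
      obtain ⟨q21, q22⟩ := q2
      obtain ⟨q31, q32⟩ := q3
      obtain ⟨q41, q42⟩ := q4
      constructor <;> linarith)
    hx0 (by simp [a1, b1])
  have hc : ∀ x ∈ Icc (0:ℝ) 1, v₁ x = v₁ x0 ∧ v₂ x = v₂ x0 := by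
    intro x hx
    have := hE x hx
    have r1 := sq_nonneg (v₁ x - v₁ x0)
    have r2 := sq_nonneg (v₂ x - v₂ x0)
    have r3 := sq_nonneg (deriv v₁ x)
    have r4 := sq_nonneg (deriv v₂ x)
    constructor
    · exact sub_eq_zero.1 (pow_eq_zero_iff two_ne_zero |>.1 (by linarith))
    · exact sub_eq_zero.1 (pow_eq_zero_iff two_ne_zero |>.1 (by linarith))
  have o1 := aux_one v₁ (v₁ x0) p1 (fun x hx => (hc x hx).1) i1
  have o2 := aux_one v₂ (v₂ x0) p2 (fun x hx => (hc x hx).2) i2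
  intro x hx
  exact ⟨(hc x hx).1.trans o1, (hc x hx).2.trans o2⟩

/-- Zeros of `v₁''` are finite in number, at most one more than the critical points of `v₂`. -/
lemma aux_upper (ν Cg l₁ l₂ : ℝ) (g₁ g₂ v₁ v₂ : ℝ → ℝ)
    (hg₁ : GAss Cg g₁)
    (hsol : IsSolution ν g₁ g₂ v₁ v₂ l₁ l₂)
    (hfin : {x ∈ Ioo (0:ℝ) 1 | deriv v₂ x = 0}.Finite) :
    {x ∈ Ioo (0:ℝ) 1 | deriv (deriv v₁) x = 0}.Finite ∧
    {x ∈ Ioo (0:ℝ) 1 | deriv (deriv v₁) x = 0}.ncard ≤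
      {x ∈ Ioo (0:ℝ) 1 | deriv v₂ x = 0}.ncard + 1 := by
  obtain ⟨c1, c2, e1, e2, p1, p2, -⟩ := hsol
  have key : ∀ s : Finset ℝ, (s : Set ℝ) ⊆ {x ∈ Ioo (0:ℝ) 1 | deriv (deriv v₁) x = 0} →
      s.card ≤ {x ∈ Ioo (0:ℝ) 1 | deriv v₂ x = 0}.ncard + 1 := by
    intro s hs
    rw [Set.ncard_eq_toFinset_card _ hfin]
    apply Finset.card_le_of_interleaved
    intro x hx y hy hxy _
    obtain ⟨hxI, hx0⟩ := hs hx
    obtain ⟨hyI, hy0⟩ := hs hy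
    obtain ⟨z, hz, hdz⟩ := exists_deriv_eq_zero hxy c2.continuous.continuousOn
      (aux_inj ν Cg l₁ g₁ v₁ v₂ hg₁ e1 p1 p2 x y (Ioo_subset_Icc_self hxI)
        (Ioo_subset_Icc_self hyI) hx0 hy0)
    refine ⟨z, ?_, hz.1, hz.2⟩
    simp only [Set.Finite.mem_toFinset, mem_ofPred_eq]
    exact ⟨⟨hxI.1.trans hz.1, hz.2.trans hyI.2⟩, hdz⟩
  have hf : {x ∈ Ioo (0:ℝ) 1 | deriv (deriv v₁) x = 0}.Finite := by
    by_contra hinf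
    obtain ⟨t, ht, hc⟩ := Set.Infinite.exists_subset_card_eq hinf
      ({x ∈ Ioo (0:ℝ) 1 | deriv v₂ x = 0}.ncard + 2)
    have := key t ht
    omega
  refine ⟨hf, ?_⟩
  rw [Set.ncard_eq_toFinset_card _ hf]
  exact key _ (by simp)

/-- Zeros of `v''` off the critical points number at least one more than the critical points. -/
lemma aux_lower (v : ℝ → ℝ) (hc : Continuous (deriv v)) (h0 : deriv v 0 = 0) (h1 : deriv v 1 = 0)
    (hA : {x ∈ Ioo (0:ℝ) 1 | deriv v x = 0}.Finite)
    (hB : {x ∈ Ioo (0:ℝ) 1 | deriv (deriv v) x = 0}.Finite) :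
    {x ∈ Ioo (0:ℝ) 1 | deriv v x = 0}.ncard + 1 ≤
      ({x ∈ Ioo (0:ℝ) 1 | deriv (deriv v) x = 0} \ {x ∈ Ioo (0:ℝ) 1 | deriv v x = 0}).ncard := by
  classical
  set S : Finset ℝ := insert 0 (insert 1 hA.toFinset) with hS
  have hcard : S.card = {x ∈ Ioo (0:ℝ) 1 | deriv v x = 0}.ncard + 2 := by
    rw [Set.ncard_eq_toFinset_card _ hA, hS, Finset.card_insert_of_notMem (by simp),
      Finset.card_insert_of_notMem (by simp)]
  have hmem : ∀ x ∈ S, x ∈ Icc (0:ℝ) 1 ∧ deriv v x = 0 := by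
    intro x hx
    simp only [hS, Finset.mem_insert, Set.Finite.mem_toFinset, mem_ofPred_eq] at hx
    rcases hx with rfl | rfl | hx
    · exact ⟨by simp, h0⟩
    · exact ⟨by simp, h1⟩
    · exact ⟨Ioo_subset_Icc_self hx.1, hx.2⟩
  have := Finset.card_le_sdiff_of_interleaved (s := S) (t := hB.toFinset) (by
    intro x hx y hy hxy _
    obtain ⟨hxI, hx0⟩ := hmem x hx
    obtain ⟨hyI, hy0⟩ := hmem y hy
    obtain ⟨z, hz, hdz⟩ := exists_deriv_eq_zero hxy hc.continuousOn (hx0.trans hy0.symm)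
    refine ⟨z, ?_, hz.1, hz.2⟩
    simp only [Set.Finite.mem_toFinset, mem_ofPred_eq]
    exact ⟨⟨hxI.1.trans_lt hz.1, hz.2.trans_le hyI.2⟩, hdz⟩)
  have h2 : (hB.toFinset \ S).card ≤
      ({x ∈ Ioo (0:ℝ) 1 | deriv (deriv v) x = 0} \ {x ∈ Ioo (0:ℝ) 1 | deriv v x = 0}).ncard := by
    rw [← Set.ncard_coe_finset]
    apply Set.ncard_le_ncard _ (hB.subset sdiff_subset)
    intro x hx
    simp only [Finset.coe_sdiff, Set.mem_sdiff, Finset.mem_coe, Set.Finite.mem_toFinset, hS,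
      Finset.mem_insert, not_or] at hx
    exact ⟨hx.1, hx.2.2.2⟩
  omega

lemma aux_isolated (f : ℝ → ℝ) (hB : {x ∈ Ioo (0:ℝ) 1 | f x = 0}.Finite) (x : ℝ) :
    ∃ ε > 0, ∀ y ∈ Ioo (0:ℝ) 1, y ≠ x → |y - x| < ε → f y ≠ 0 := by
  have hcl := (hB.subset (sdiff_subset (t := {x}))).isClosed
  obtain ⟨ε, hε, h⟩ := Metric.isOpen_iff.1 hcl.isOpen_compl x (by simp)
  refine ⟨ε, hε, fun y hy hne hd h0 => ?_⟩
  exact h (show y ∈ Metric.ball x ε by rwa [Metric.mem_ball, Real.dist_eq]) ⟨⟨hy, h0⟩, hne⟩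

lemma aux_nondeg (A B : Set ℝ) (hB : B.Finite) (h : B.ncard ≤ (B \ A).ncard) :
    ∀ x ∈ A, x ∉ B := by
  intro x hxA hxB
  have : (B \ A).ncard < B.ncard :=
    Set.ncard_lt_ncard ⟨sdiff_subset, fun hh => (hh hxB).2 hxA⟩ hB
  omega

theorem stmt_9 (ν Cg l₁ l₂ : ℝ) (g₁ g₂ v₁ v₂ : ℝ → ℝ)
    (hν : 0 < ν) (hCg : 0 < Cg) (hg₁ : GAss Cg g₁) (hg₂ : GAss Cg g₂)
    (hsol : IsSolution ν g₁ g₂ v₁ v₂ l₁ l₂)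
    (hnt : ¬ IsTrivialSol v₁ v₂) :
    ∃ k : ℕ,
      ({x ∈ Set.Ioo (0:ℝ) 1 | deriv v₁ x = 0}.Finite ∧
        {x ∈ Set.Ioo (0:ℝ) 1 | deriv v₁ x = 0}.ncard = k ∧
        (∀ x ∈ Set.Ioo (0:ℝ) 1, deriv v₁ x = 0 → deriv (deriv v₁) x ≠ 0) ∧
        {x ∈ Set.Ioo (0:ℝ) 1 | deriv (deriv v₁) x = 0}.Finite ∧
        {x ∈ Set.Ioo (0:ℝ) 1 | deriv (deriv v₁) x = 0}.ncard = k + 1 ∧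
        (∀ x ∈ Set.Ioo (0:ℝ) 1, deriv (deriv v₁) x = 0 →
          ∃ ε > 0, ∀ y ∈ Set.Ioo (0:ℝ) 1, y ≠ x → |y - x| < ε →
            deriv (deriv v₁) y ≠ 0)) ∧
      ({x ∈ Set.Ioo (0:ℝ) 1 | deriv v₂ x = 0}.Finite ∧
        {x ∈ Set.Ioo (0:ℝ) 1 | deriv v₂ x = 0}.ncard = k ∧
        (∀ x ∈ Set.Ioo (0:ℝ) 1, deriv v₂ x = 0 → deriv (deriv v₂) x ≠ 0) ∧
        {x ∈ Set.Ioo (0:ℝ) 1 | deriv (deriv v₂) x = 0}.Finite ∧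
        {x ∈ Set.Ioo (0:ℝ) 1 | deriv (deriv v₂) x = 0}.ncard = k + 1 ∧
        (∀ x ∈ Set.Ioo (0:ℝ) 1, deriv (deriv v₂) x = 0 →
          ∃ ε > 0, ∀ y ∈ Set.Ioo (0:ℝ) 1, y ≠ x → |y - x| < ε →
            deriv (deriv v₂) y ≠ 0)) := by
  have hsol' := aux_symm hsol
  have hnt' : ¬ IsTrivialSol v₂ v₁ := fun h => hnt fun x hx => (h x hx).symm
  have A1 := aux_finite ν Cg l₁ l₂ g₁ g₂ v₁ v₂ hν hg₁ hg₂ hsol hnt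
  have A2 := aux_finite ν Cg l₂ l₁ g₂ g₁ v₂ v₁ hν hg₂ hg₁ hsol' hnt'
  obtain ⟨B1, n1⟩ := aux_upper ν Cg l₁ l₂ g₁ g₂ v₁ v₂ hg₁ hsol A2
  obtain ⟨B2, n2⟩ := aux_upper ν Cg l₂ l₁ g₂ g₁ v₂ v₁ hg₂ hsol' A1
  obtain ⟨c1, c2, -, -, -, -, z1, z2, z3, z4, -⟩ := hsol
  have m1 := aux_lower v₁ (c1.continuous_deriv (by norm_num)) z1 z2 A1 B1
  have m2 := aux_lower v₂ (c2.continuous_deriv (by norm_num)) z3 z4 A2 B2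
  have r1 := Set.ncard_le_ncard (sdiff_subset (s := {x ∈ Ioo (0:ℝ) 1 | deriv (deriv v₁) x = 0})
    (t := {x ∈ Ioo (0:ℝ) 1 | deriv v₁ x = 0})) B1
  have r2 := Set.ncard_le_ncard (sdiff_subset (s := {x ∈ Ioo (0:ℝ) 1 | deriv (deriv v₂) x = 0})
    (t := {x ∈ Ioo (0:ℝ) 1 | deriv v₂ x = 0})) B2
  have w1 := aux_nondeg {x ∈ Ioo (0:ℝ) 1 | deriv v₁ x = 0} _ B1 (by omega)
  have w2 := aux_nondeg {x ∈ Ioo (0:ℝ) 1 | deriv v₂ x = 0} _ B2 (by omega)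
  refine ⟨{x ∈ Ioo (0:ℝ) 1 | deriv v₁ x = 0}.ncard,
    ⟨A1, rfl, fun x hx h h' => w1 x ⟨hx, h⟩ ⟨hx, h'⟩, B1, by omega,
      fun x _ _ => aux_isolated _ B1 x⟩,
    ⟨A2, by omega, fun x hx h h' => w2 x ⟨hx, h⟩ ⟨hx, h'⟩, B2, by omega,
      fun x _ _ => aux_isolated _ B2 x⟩⟩
end

section
/- Let V₁, V₂ ∈ C²(ℝ) with 0 ≤ V_i ≤ M on ℝ, let Λ₁, Λ₂ ≥ 0, and suppose −V_i'' = (Λ_i − g_i(V_j²)) V_i on ℝ for i = 1,2 (j = 3−i). Assume moreover that each V_i has only finitely many monotonicity intervals, i.e. there exist finitely many points t₀ < t₁ < ⋯ < t_m such that V_i is monotone on (−∞,t₀], on each [t_l, t_{l+1}], and on [t_m,∞). Then one of the following holds: (1) V₁ ≡ 0 and Λ₂ = 0; (2) V₂ ≡ 0 and Λ₁ = 0; (3) V₁ ≡ V₂ ≡ 0; (4) g_i(V_j²) ≡ Λ_i on ℝ for i = 1,2. -/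
open Set Filter MeasureTheory

/-- `f` is monotone (nondecreasing or nonincreasing) on `s`. -/
def MonoOrAntiOn (f : ℝ → ℝ) (s : Set ℝ) : Prop :=
  MonotoneOn f s ∨ AntitoneOn f s

/-- `f` has only finitely many monotonicity intervals: there are points
`t 0 < t 1 < ⋯ < t m` such that `f` is monotone on `(-∞, t 0]`, on each
`[t l, t (l+1)]`, and on `[t m, ∞)`. -/
def FinitelyManyMonotonicityIntervals (f : ℝ → ℝ) : Prop :=
  ∃ (m : ℕ) (t : ℕ → ℝ),
    (∀ l, l < m → t l < t (l + 1)) ∧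
    MonoOrAntiOn f (Set.Iic (t 0)) ∧
    (∀ l, l < m → MonoOrAntiOn f (Set.Icc (t l) (t (l + 1)))) ∧
    MonoOrAntiOn f (Set.Ici (t m))

open Topology

lemma aux_L0 {f f' f'' : ℝ → ℝ} (h1 : ∀ x, HasDerivAt f (f' x) x)
    (h2 : ∀ x, HasDerivAt f' (f'' x) x) {a b : ℝ} (hab : a ≤ b)
    (hn : ∀ x ∈ Icc a b, 0 ≤ f'' x) :
    f' a ≤ f' b ∧ f a + f' a * (b - a) ≤ f b ∧ f b + f' b * (a - b) ≤ f a := by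
  have mono : MonotoneOn f' (Icc a b) := by
    apply monotoneOn_of_deriv_nonneg (convex_Icc a b)
    · exact fun x _ => (h2 x).continuousAt.continuousWithinAt
    · exact fun x _ => (h2 x).differentiableAt.differentiableWithinAt
    · intro x hx
      rw [(h2 x).deriv]
      exact hn x (interior_subset hx)
  have ha : a ∈ Icc a b := ⟨le_refl a, hab⟩
  have hb : b ∈ Icc a b := ⟨hab, le_refl b⟩
  have hc : ContinuousOn f (Icc a b) := fun x _ => (h1 x).continuousAt.continuousWithinAt
  have hd : DifferentiableOn ℝ f (interior (Icc a b)) :=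
    fun x _ => (h1 x).differentiableAt.differentiableWithinAt
  refine ⟨mono ha hb hab, ?_, ?_⟩
  · have := (convex_Icc a b).mul_sub_le_image_sub_of_le_deriv hc hd (C := f' a)
      (fun x hx => by
        rw [(h1 x).deriv]
        exact mono ha (interior_subset hx) (interior_subset hx).1) a ha b hb hab
    linarith
  · have := (convex_Icc a b).image_sub_le_mul_sub_of_deriv_le hc hd (C := f' b)
      (fun x hx => by
        rw [(h1 x).deriv]
        exact mono (interior_subset hx) hb (interior_subset hx).2) a ha b hb hab
    linarith

/-- convex and bounded above near infinity: derivative nonpositive, antitone -/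
lemma aux_L1 {f f' f'' : ℝ → ℝ} (h1 : ∀ x, HasDerivAt f (f' x) x)
    (h2 : ∀ x, HasDerivAt f' (f'' x) x) {T B : ℝ}
    (hn : ∀ x, T ≤ x → 0 ≤ f'' x) (hB : ∀ x, f x ≤ B) :
    (∀ x, T ≤ x → f' x ≤ 0) ∧ ∀ x y, T ≤ x → x ≤ y → f y ≤ f x := by
  have key : ∀ x, T ≤ x → f' x ≤ 0 := by
    intro x hx
    by_contra! hpos
    have hBx : 0 ≤ B - f x := by linarith [hB x]
    have hq : 0 ≤ (B - f x + 1) / f' x := by positivity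
    have := (aux_L0 h1 h2 (a := x) (b := x + (B - f x + 1) / f' x) (by linarith)
      (fun z hz => hn z (by linarith [hz.1]))).2.1
    have e : f' x * (x + (B - f x + 1) / f' x - x) = B - f x + 1 := by
      field_simp
      ring
    rw [e] at this
    linarith [hB (x + (B - f x + 1) / f' x)]
  refine ⟨key, ?_⟩
  intro x y hx hxy
  have h := (aux_L0 h1 h2 hxy (fun z hz => hn z (by linarith [hz.1]))).2.2
  have := key y (by linarith)
  nlinarith

lemma aux_L2 {f f' f'' : ℝ → ℝ} (h1 : ∀ x, HasDerivAt f (f' x) x)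
    (h2 : ∀ x, HasDerivAt f' (f'' x) x) {T B c : ℝ} (hc : 0 < c)
    (hn : ∀ x, T ≤ x → c ≤ f'' x) (hB : ∀ x, f x ≤ B) : False := by
  have h := (aux_L1 h1 h2 (fun x hx => by linarith [hn x hx]) hB).1
  have hT := h T le_rfl
  have hq : 0 ≤ (- f' T + 1) / c := div_nonneg (by linarith) hc.le
  have k : ∀ x, HasDerivAt (fun x => f' x - c * x) (f'' x - c) x := by
    intro x
    have := (h2 x).fun_sub ((hasDerivAt_id x).const_mul c)
    rw [mul_one] at this
    exact this
  have mono : MonotoneOn (fun x => f' x - c * x) (Ici T) := by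
    apply monotoneOn_of_deriv_nonneg (convex_Ici T)
    · exact fun x _ => (k x).continuousAt.continuousWithinAt
    · exact fun x _ => (k x).differentiableAt.differentiableWithinAt
    · intro x hx
      rw [(k x).deriv]
      linarith [hn x (interior_subset hx)]
  have h3 := h (T + (- f' T + 1) / c) (by linarith)
  have h4 := mono (a := T) (b := T + (- f' T + 1) / c) (by simp) (by simpa using hq) (by linarith)
  have e : c * ((- f' T + 1) / c) = - f' T + 1 := by field_simp
  simp only [mul_add, e] at h4
  linarith

lemma aux_lim {f f' f'' : ℝ → ℝ} (h1 : ∀ x, HasDerivAt f (f' x) x)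
    (h2 : ∀ x, HasDerivAt f' (f'' x) x) {B b : ℝ} (hB : ∀ x, |f x| ≤ B)
    (ht : Tendsto f'' atTop (𝓝 b)) : b = 0 := by
  rcases lt_trichotomy b 0 with h | h | h
  · exfalso
    have := ht.eventually_le_const (show b < b / 2 by linarith)
    obtain ⟨T, hT⟩ := eventually_atTop.1 this
    exact aux_L2 (f := fun x => - f x) (f' := fun x => - f' x) (f'' := fun x => - f'' x)
      (fun x => (h1 x).neg) (fun x => (h2 x).neg) (c := - (b/2)) (T := T) (B := B) (by linarith)
      (fun x hx => by linarith [hT x hx]) (fun x => by linarith [(abs_le.1 (hB x)).1])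
  · exact h
  · exfalso
    have := ht.eventually_const_le (show b / 2 < b by linarith)
    obtain ⟨T, hT⟩ := eventually_atTop.1 this
    exact aux_L2 h1 h2 (c := b/2) (T := T) (B := B) (by linarith)
      (fun x hx => hT x hx) (fun x => (abs_le.1 (hB x)).2)

lemma aux_const {f f' f'' : ℝ → ℝ} (h1 : ∀ x, HasDerivAt f (f' x) x)
    (h2 : ∀ x, HasDerivAt f' (f'' x) x) {B a : ℝ} (hB : ∀ x, |f x| ≤ B)
    (hn : ∀ x, 0 ≤ f'' x) (ht : Tendsto f atTop (𝓝 a)) : ∀ x, f x = a := by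
  have hle : ∀ x, f' x ≤ 0 := fun x =>
    (aux_L1 h1 h2 (T := x) (fun y _ => hn y) (fun x => (abs_le.1 (hB x)).2)).1 x le_rfl
  have h0 : ∀ x, f' x = 0 := by
    intro x
    by_contra hne
    have hneg : f' x < 0 := lt_of_le_of_ne (hle x) hne
    have hBx : 0 ≤ B - f x := by linarith [(abs_le.1 (hB x)).2]
    have hq : 0 ≤ (B - f x + 1) / (- f' x) := div_nonneg (by linarith) (by linarith)
    have := (aux_L0 h1 h2 (a := x - (B - f x + 1) / (- f' x)) (b := x) (by linarith)
      (fun z hz => hn z)).2.2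
    have e : f' x * (x - (B - f x + 1) / (- f' x) - x) = B - f x + 1 := by
      field_simp
      ring
    rw [e] at this
    linarith [(abs_le.1 (hB (x - (B - f x + 1) / (- f' x)))).2]
  have hc : ∀ x y, f x = f y := is_const_of_deriv_eq_zero
    (fun x => (h1 x).differentiableAt) (fun x => by rw [(h1 x).deriv, h0])
  intro x
  have : f = fun _ => f x := funext fun y => hc y x
  rw [this] at ht
  exact tendsto_nhds_unique tendsto_const_nhds ht

lemma aux_evmono {f : ℝ → ℝ} {M : ℝ} (hb : ∀ x, 0 ≤ f x ∧ f x ≤ M)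
    (hf : FinitelyManyMonotonicityIntervals f) :
    ∃ a T, Tendsto f atTop (𝓝 a) ∧ ((∀ x, T ≤ x → f x ≤ a) ∨ (∀ x, T ≤ x → a ≤ f x)) := by
  obtain ⟨m, t, -, -, -, h⟩ := hf
  have ev : (fun x => f (max x (t m))) =ᶠ[atTop] f := by
    filter_upwards [eventually_ge_atTop (t m)] with x hx
    rw [max_eq_left hx]
  rcases h with h | h
  · have mono : Monotone (fun x => f (max x (t m))) := fun x y hxy =>
      h (mem_Ici.2 (le_max_right _ _)) (mem_Ici.2 (le_max_right _ _)) (max_le_max_right _ hxy)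
    have bd : BddAbove (range (fun x => f (max x (t m)))) :=
      ⟨M, by rintro _ ⟨x, rfl⟩; exact (hb _).2⟩
    refine ⟨_, t m, (tendsto_atTop_ciSup mono bd).congr' ev, Or.inl fun x hx => ?_⟩
    have := le_ciSup bd x
    simpa [max_eq_left hx] using this
  · have mono : Antitone (fun x => f (max x (t m))) := fun x y hxy =>
      h (mem_Ici.2 (le_max_right _ _)) (mem_Ici.2 (le_max_right _ _)) (max_le_max_right _ hxy)
    have bd : BddBelow (range (fun x => f (max x (t m)))) :=
      ⟨0, by rintro _ ⟨x, rfl⟩; exact (hb _).1⟩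
    refine ⟨_, t m, (tendsto_atTop_ciInf mono bd).congr' ev, Or.inr fun x hx => ?_⟩
    have := ciInf_le bd x
    simpa [max_eq_left hx] using this

lemma aux_U {u u' u'' w w' w'' : ℝ → ℝ} (hu1 : ∀ x, HasDerivAt u (u' x) x)
    (hu2 : ∀ x, HasDerivAt u' (u'' x) x) (hw1 : ∀ x, HasDerivAt w (w' x) x)
    (hw2 : ∀ x, HasDerivAt w' (w'' x) x) {K T : ℝ} (hK : 0 ≤ K)
    (hu : ∀ x, |u'' x| ≤ K * (|u x| + |w x|)) (hw : ∀ x, |w'' x| ≤ K * (|u x| + |w x|))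
    (h1 : u T = 0) (h2 : u' T = 0) (h3 : w T = 0) (h4 : w' T = 0) :
    ∀ x, u x = 0 ∧ w x = 0 := by
  set E : ℝ → ℝ := fun x => u x ^ 2 + w x ^ 2 + u' x ^ 2 + w' x ^ 2 with hE
  set E' : ℝ → ℝ := fun x => 2 * (u x * u' x + w x * w' x + u' x * u'' x + w' x * w'' x) with hE'
  have dE : ∀ x, HasDerivAt E (E' x) x := by
    intro x
    have := ((((hu1 x).pow 2).add ((hw1 x).pow 2)).add ((hu2 x).pow 2)).add ((hw2 x).pow 2)
    refine HasDerivAt.congr_deriv (f := E) this ?_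
    simp only [hE']
    norm_num
    ring
  have prod : ∀ p q r s : ℝ, |q| ≤ K * (|r| + |s|) →
      |2 * (p * q)| ≤ K * (2 * p ^ 2 + r ^ 2 + s ^ 2) := by
    intro p q r s h
    rw [abs_mul, abs_mul, abs_two, ← sq_abs p, ← sq_abs r, ← sq_abs s]
    have h5 : |p| * |q| ≤ |p| * (K * (|r| + |s|)) := mul_le_mul_of_nonneg_left h (abs_nonneg p)
    have h6 := mul_nonneg hK (sq_nonneg (|p| - |r|))
    have h7 := mul_nonneg hK (sq_nonneg (|p| - |s|))
    nlinarith
  have bE : ∀ x, |E' x| ≤ (1 + 2 * K) * E x := by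
    intro x
    have p1 := abs_le.1 (prod (u' x) _ _ _ (hu x))
    have p2 := abs_le.1 (prod (w' x) _ _ _ (hw x))
    simp only [hE, hE']
    rw [abs_le]
    constructor <;> nlinarith [sq_nonneg (u x + u' x), sq_nonneg (u x - u' x),
      sq_nonneg (w x + w' x), sq_nonneg (w x - w' x)]
  set C := 1 + 2 * K with hC
  have ET : E T = 0 := by simp [hE, h1, h2, h3, h4]
  have dexp : ∀ c x : ℝ, HasDerivAt (fun x => Real.exp (c * x)) (Real.exp (c * x) * c) x := by
    intro c x
    simpa using ((hasDerivAt_id x).const_mul c).exp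
  have m1 : Monotone (fun x => E x * Real.exp (C * x)) := by
    apply monotone_of_deriv_nonneg
    · exact fun x => ((dE x).mul (dexp C x)).differentiableAt
    · intro x
      have := ((dE x).mul (dexp C x)).deriv
      have e : deriv (fun x => E x * Real.exp (C * x)) x = _ := this
      rw [e]
      have := (abs_le.1 (bE x)).1
      have h5 := mul_nonneg (Real.exp_pos (C * x)).le (show 0 ≤ E' x + C * E x by linarith)
      show (0:ℝ) ≤ _
      nlinarith
  have m2 : Antitone (fun x => E x * Real.exp (-C * x)) := by
    apply antitone_of_deriv_nonpos
    · exact fun x => ((dE x).mul (dexp (-C) x)).differentiableAt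
    · intro x
      have := ((dE x).mul (dexp (-C) x)).deriv
      have e : deriv (fun x => E x * Real.exp (-C * x)) x = _ := this
      rw [e]
      have := (abs_le.1 (bE x)).2
      have h5 := mul_nonneg (Real.exp_pos (-C * x)).le (show 0 ≤ C * E x - E' x by linarith)
      show _ ≤ (0:ℝ)
      nlinarith
  have E0 : ∀ x, E x ≤ 0 := by
    intro x
    rcases le_total x T with h | h
    · have := m1 h
      simp only [ET, zero_mul] at this
      by_contra! hp
      linarith [mul_pos hp (Real.exp_pos (C * x))]
    · have := m2 h
      simp only [ET, zero_mul] at this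
      by_contra! hp
      linarith [mul_pos hp (Real.exp_pos (-C * x))]
  intro x
  have := E0 x
  simp only [hE] at this
  constructor
  · exact pow_eq_zero_iff (two_ne_zero) |>.1 (by nlinarith [sq_nonneg (u x), sq_nonneg (w x), sq_nonneg (u' x), sq_nonneg (w' x)])
  · exact pow_eq_zero_iff (two_ne_zero) |>.1 (by nlinarith [sq_nonneg (u x), sq_nonneg (w x), sq_nonneg (u' x), sq_nonneg (w' x)])

lemma aux_deriv0 {f f' : ℝ → ℝ} (h1 : ∀ x, HasDerivAt f (f' x) x) {T : ℝ}
    (h : ∀ x, T < x → f x = 0) : ∀ x, T < x → f' x = 0 := by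
  intro x hx
  have ev : f =ᶠ[𝓝 x] fun _ => 0 := by
    filter_upwards [lt_mem_nhds hx] with y hy using h y hy
  exact (h1 x).unique ((hasDerivAt_const x (0:ℝ)).congr_of_eventuallyEq ev)

/-- if `u` vanishes near infinity then everything vanishes -/
lemma aux_HZ {u u' u'' w w' w'' : ℝ → ℝ} (hu1 : ∀ x, HasDerivAt u (u' x) x)
    (hu2 : ∀ x, HasDerivAt u' (u'' x) x) (hw1 : ∀ x, HasDerivAt w (w' x) x)
    (hw2 : ∀ x, HasDerivAt w' (w'' x) x) {K T : ℝ} (hK : 0 ≤ K)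
    (hu : ∀ x, |u'' x| ≤ K * (|u x| + |w x|)) (hw : ∀ x, |w'' x| ≤ K * (|u x| + |w x|))
    (huw : ∀ x, u x = 0 → u'' x = 0 → w x = 0) (h0 : ∀ x, T < x → u x = 0) :
    ∀ x, u x = 0 ∧ w x = 0 := by
  have a1 := aux_deriv0 hu1 h0
  have a2 := aux_deriv0 hu2 a1
  have a3 : ∀ x, T < x → w x = 0 := fun x hx => huw x (h0 x hx) (a2 x hx)
  have a4 := aux_deriv0 hw1 a3
  have hT : T < T + 1 := by linarith
  exact aux_U hu1 hu2 hw1 hw2 hK hu hw (h0 _ hT) (a1 _ hT) (a3 _ hT) (a4 _ hT)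

lemma aux_blow {u u' u'' w w' w'' : ℝ → ℝ} (hu1 : ∀ x, HasDerivAt u (u' x) x)
    (hu2 : ∀ x, HasDerivAt u' (u'' x) x) (hw1 : ∀ x, HasDerivAt w (w' x) x)
    (hw2 : ∀ x, HasDerivAt w' (w'' x) x) {B T : ℝ} (hB : ∀ x, |u x| ≤ B)
    (sp1 : ∀ x, 0 ≤ w x → 0 ≤ u'' x) (sp2 : ∀ x, 0 ≤ u x → 0 ≤ w'' x)
    (h1 : 0 < u T) (h2 : 0 < w T) (h3 : u' T < 0) (h4 : w' T ≤ 0) : False := by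
  have cu : Continuous u := continuous_iff_continuousAt.2 fun x => (hu1 x).continuousAt
  have cw : Continuous w := continuous_iff_continuousAt.2 fun x => (hw1 x).continuousAt
  have key : ∀ x, x ≤ T → 0 < u x ∧ 0 < w x := by
    by_contra! hcon
    obtain ⟨x0, hx0, hbad⟩ := hcon
    set S : Set ℝ := {x | x ≤ T ∧ min (u x) (w x) ≤ 0} with hS
    have cl : IsClosed S :=
      (isClosed_le continuous_id continuous_const).inter
        (isClosed_le (cu.min cw) continuous_const)
    have ne : S.Nonempty := by
      refine ⟨x0, hx0, ?_⟩
      rcases le_or_gt (u x0) 0 with h | h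
      · exact (min_le_left _ _).trans h
      · exact (min_le_right _ _).trans (hbad h)
    have bd : BddAbove S := ⟨T, fun x hx => hx.1⟩
    have hs := cl.csSup_mem ne bd
    set s := sSup S
    have hsT : s ≤ T := hs.1
    have pos : ∀ x, s < x → x ≤ T → 0 < u x ∧ 0 < w x := by
      intro x hx hxT
      have : x ∉ S := fun h => absurd (le_csSup bd h) (not_le.2 hx)
      simp only [hS, mem_ofPred_eq, not_and, not_le] at this
      exact lt_min_iff.1 (this hxT)
    have hne : s ≠ T := by
      intro h
      have := hs.2
      rw [h] at this
      exact absurd (lt_min h1 h2) (not_lt.2 this)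
    have hlt : s < T := lt_of_le_of_ne hsT hne
    have clos : ∀ f : ℝ → ℝ, Continuous f → (∀ x, s < x → x ≤ T → 0 < f x) →
        ∀ x ∈ Icc s T, 0 ≤ f x := by
      intro f cf hf x hx
      have hc : Icc s T ⊆ closure (Ioc s T) := by rw [closure_Ioc hne]
      have : closure (Ioc s T) ⊆ {x | 0 ≤ f x} :=
        closure_minimal (fun y hy => (hf y hy.1 hy.2).le) (isClosed_le continuous_const cf)
      exact this (hc hx)
    have pu := clos u cu (fun x a b => (pos x a b).1)
    have pw := clos w cw (fun x a b => (pos x a b).2)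
    have q1 := (aux_L0 hu1 hu2 hsT (fun x hx => sp1 x (pw x hx))).2.2
    have q2 := (aux_L0 hw1 hw2 hsT (fun x hx => sp2 x (pu x hx))).2.2
    have r1 : 0 < u s := by nlinarith
    have r2 : 0 < w s := by nlinarith
    exact absurd (lt_min r1 r2) (not_lt.2 hs.2)
  have hBx : 0 ≤ B - u T := by linarith [(abs_le.1 (hB T)).2]
  have hq : 0 ≤ (B - u T + 1) / (- u' T) := div_nonneg (by linarith) (by linarith)
  have := (aux_L0 hu1 hu2 (a := T - (B - u T + 1) / (- u' T)) (b := T) (by linarith)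
    (fun z hz => sp1 z (key z hz.2).2.le)).2.2
  have hne : u' T ≠ 0 := h3.ne
  have e : u' T * (T - (B - u T + 1) / (- u' T) - T) = B - u T + 1 := by
    field_simp
    ring
  rw [e] at this
  linarith [(abs_le.1 (hB (T - (B - u T + 1) / (- u' T)))).2]

lemma aux_Hpos {u u' u'' w w' w'' : ℝ → ℝ} (hu1 : ∀ x, HasDerivAt u (u' x) x)
    (hu2 : ∀ x, HasDerivAt u' (u'' x) x) (hw1 : ∀ x, HasDerivAt w (w' x) x)
    (hw2 : ∀ x, HasDerivAt w' (w'' x) x) {K T B : ℝ} (hK : 0 ≤ K)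
    (hu : ∀ x, |u'' x| ≤ K * (|u x| + |w x|)) (hw : ∀ x, |w'' x| ≤ K * (|u x| + |w x|))
    (huw : ∀ x, u x = 0 → u'' x = 0 → w x = 0) (hwu : ∀ x, w x = 0 → w'' x = 0 → u x = 0)
    (hBu : ∀ x, |u x| ≤ B) (hBw : ∀ x, |w x| ≤ B)
    (sp1 : ∀ x, 0 ≤ w x → 0 ≤ u'' x) (sp2 : ∀ x, 0 ≤ u x → 0 ≤ w'' x)
    (tu : Tendsto u atTop (𝓝 0)) (tw : Tendsto w atTop (𝓝 0))
    (hT : ∀ x, T ≤ x → 0 ≤ u x) : ∀ x, u x = 0 ∧ w x = 0 := by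
  obtain ⟨dw, aw⟩ := aux_L1 hw1 hw2 (T := T) (fun x hx => sp2 x (hT x hx))
    (fun x => (abs_le.1 (hBw x)).2)
  have hTw : ∀ x, T ≤ x → 0 ≤ w x := fun x hx => le_of_tendsto tw (by
    filter_upwards [eventually_ge_atTop x] with y hy using aw x y hx hy)
  obtain ⟨du, au⟩ := aux_L1 hu1 hu2 (T := T) (fun x hx => sp1 x (hTw x hx))
    (fun x => (abs_le.1 (hBu x)).2)
  rcases (hT T le_rfl).eq_or_lt with h | h
  · exact aux_HZ hu1 hu2 hw1 hw2 hK hu hw huw (T := T) (fun x hx =>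
      le_antisymm ((au T x le_rfl hx.le).trans h.symm.le) (hT x hx.le))
  rcases (hTw T le_rfl).eq_or_lt with h' | h'
  · have := aux_HZ hw1 hw2 hu1 hu2 hK (fun x => by rw [add_comm]; exact hw x)
      (fun x => by rw [add_comm]; exact hu x) hwu (T := T) (fun x hx =>
      le_antisymm ((aw T x le_rfl hx.le).trans h'.symm.le) (hTw x hx.le))
    exact fun x => (this x).symm
  exfalso
  have hneg : u' T < 0 := by
    refine lt_of_le_of_ne (du T le_rfl) fun h0 => ?_
    have : u T ≤ 0 := ge_of_tendsto tu (by
      filter_upwards [eventually_ge_atTop T] with y hy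
      have := (aux_L0 hu1 hu2 hy (fun z hz => sp1 z (hTw z hz.1))).2.1
      rw [h0] at this
      linarith)
    linarith
  exact aux_blow hu1 hu2 hw1 hw2 hBu sp1 sp2 h h' hneg (dw T le_rfl)

lemma aux_H {u u' u'' w w' w'' : ℝ → ℝ} (hu1 : ∀ x, HasDerivAt u (u' x) x)
    (hu2 : ∀ x, HasDerivAt u' (u'' x) x) (hw1 : ∀ x, HasDerivAt w (w' x) x)
    (hw2 : ∀ x, HasDerivAt w' (w'' x) x) {K T B : ℝ} (hK : 0 ≤ K)
    (hu : ∀ x, |u'' x| ≤ K * (|u x| + |w x|)) (hw : ∀ x, |w'' x| ≤ K * (|u x| + |w x|))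
    (huw : ∀ x, u x = 0 → u'' x = 0 → w x = 0) (hwu : ∀ x, w x = 0 → w'' x = 0 → u x = 0)
    (hBu : ∀ x, |u x| ≤ B) (hBw : ∀ x, |w x| ≤ B)
    (sp1 : ∀ x, 0 ≤ w x → 0 ≤ u'' x) (sp2 : ∀ x, 0 ≤ u x → 0 ≤ w'' x)
    (sn1 : ∀ x, w x ≤ 0 → u'' x ≤ 0) (sn2 : ∀ x, u x ≤ 0 → w'' x ≤ 0)
    (tu : Tendsto u atTop (𝓝 0)) (tw : Tendsto w atTop (𝓝 0))
    (hT : (∀ x, T ≤ x → u x ≤ 0) ∨ (∀ x, T ≤ x → 0 ≤ u x)) : ∀ x, u x = 0 ∧ w x = 0 := by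
  rcases hT with hT | hT
  · have := aux_Hpos (u := fun x => - u x) (u' := fun x => - u' x) (u'' := fun x => - u'' x)
      (w := fun x => - w x) (w' := fun x => - w' x) (w'' := fun x => - w'' x)
      (fun x => (hu1 x).neg) (fun x => (hu2 x).neg) (fun x => (hw1 x).neg) (fun x => (hw2 x).neg)
      (K := K) (T := T) (B := B) hK (by simpa using hu) (by simpa using hw) (by simpa using huw)
      (by simpa using hwu) (by simpa using hBu) (by simpa using hBw) (by simpa using sn1)
      (by simpa using sn2) (by simpa using tu.neg) (by simpa using tw.neg) (by simpa using hT)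
    simpa using this
  · exact aux_Hpos hu1 hu2 hw1 hw2 hK hu hw huw hwu hBu hBw sp1 sp2 tu tw hT

lemma aux_g0 {Cg : ℝ} {g : ℝ → ℝ} (h : GAss Cg g) : g 0 = 0 := by
  have := h.2.2 0 le_rfl
  simp at this
  linarith

lemma aux_gpos {Cg : ℝ} {g : ℝ → ℝ} (h : GAss Cg g) {s : ℝ} (hs : 0 ≤ s) : 0 ≤ g s := by
  rw [← aux_g0 h]
  exact h.2.1.monotoneOn (by simp) hs hs

lemma aux_glim {Cg : ℝ} {g V : ℝ → ℝ} (h : GAss Cg g) {a : ℝ}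
    (hV : Tendsto V atTop (𝓝 a)) : Tendsto (fun x => g (V x ^ 2)) atTop (𝓝 (g (a ^ 2))) := by
  have hc : ContinuousWithinAt g (Ici 0) (a ^ 2) := h.1.continuousOn _ (sq_nonneg a)
  exact hc.tendsto.comp (tendsto_nhdsWithin_iff.2 ⟨hV.pow 2, .of_forall fun x => mem_Ici.2 (sq_nonneg _)⟩)

lemma aux_glip {Cg : ℝ} {g : ℝ → ℝ} (h : GAss Cg g) (M : ℝ) :
    ∃ K : ℝ, 0 ≤ K ∧ ∀ x y, 0 ≤ x → x ≤ M → 0 ≤ y → y ≤ M →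
      |g (x ^ 2) - g (y ^ 2)| ≤ K * |x - y| := by
  have hc : ContDiffOn ℝ 1 g (Icc 0 (M ^ 2)) :=
    (h.1.of_le (by norm_num)).mono Icc_subset_Ici_self
  obtain ⟨K, hK⟩ := hc.exists_lipschitzOnWith (by norm_num) (convex_Icc _ _) isCompact_Icc
  refine ⟨K * (2 * |M|), by positivity, ?_⟩
  intro x y hx hxM hy hyM
  have := hK.dist_le_mul (x ^ 2) ⟨sq_nonneg _, by gcongr⟩ (y ^ 2) ⟨sq_nonneg _, by gcongr⟩
  rw [Real.dist_eq, Real.dist_eq] at this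
  refine this.trans ?_
  rw [mul_assoc]
  refine mul_le_mul_of_nonneg_left ?_ K.2
  rw [show x ^ 2 - y ^ 2 = (x + y) * (x - y) by ring, abs_mul]
  refine mul_le_mul_of_nonneg_right ?_ (abs_nonneg _)
  rw [abs_of_nonneg (by linarith)]
  linarith [le_abs_self M]

/-- concave near infinity, nonnegative, bounded, tends to `0`, linear ODE: vanishes -/
lemma aux_vanish {f f' f'' : ℝ → ℝ} (h1 : ∀ x, HasDerivAt f (f' x) x)
    (h2 : ∀ x, HasDerivAt f' (f'' x) x) {T K : ℝ} (hK : 0 ≤ K)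
    (hn : ∀ x, T ≤ x → f'' x ≤ 0) (h0 : ∀ x, 0 ≤ f x) (ht : Tendsto f atTop (𝓝 0))
    (hb : ∀ x, |f'' x| ≤ K * |f x|) : ∀ x, f x = 0 := by
  have am := (aux_L1 (f := fun x => - f x) (f' := fun x => - f' x) (f'' := fun x => - f'' x)
    (fun x => (h1 x).neg) (fun x => (h2 x).neg) (T := T) (B := 0)
    (fun x hx => by linarith [hn x hx]) (fun x => by linarith [h0 x])).2
  have z : ∀ x, T < x → f x = 0 := fun x hx => le_antisymm (ge_of_tendsto ht (by
    filter_upwards [eventually_ge_atTop x] with y hy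
    linarith [am x y hx.le hy])) (h0 x)
  have a1 := aux_deriv0 h1 z
  have hT : T < T + 1 := by linarith
  have := aux_U h1 h2 h1 h2 (K := K) (T := T + 1) hK
    (fun x => (hb x).trans (mul_le_mul_of_nonneg_left (by linarith [abs_nonneg (f x)]) hK))
    (fun x => (hb x).trans (mul_le_mul_of_nonneg_left (by linarith [abs_nonneg (f x)]) hK))
    (z _ hT) (a1 _ hT) (z _ hT) (a1 _ hT)
  exact fun x => (this x).1

lemma aux_sign {Cg A L : ℝ} {g V : ℝ → ℝ} (h : GAss Cg g) (hA : 0 ≤ A) (hL : g (A ^ 2) = L)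
    (hV : ∀ x, 0 ≤ V x) :
    (∀ x, 0 ≤ V x - A → 0 ≤ g (V x ^ 2) - L) ∧ (∀ x, V x - A ≤ 0 → g (V x ^ 2) - L ≤ 0) ∧
    (∀ x, g (V x ^ 2) - L = 0 → V x - A = 0) := by
  subst hL
  refine ⟨fun x hx => ?_, fun x hx => ?_, fun x hx => ?_⟩
  · have := h.2.1.monotoneOn (a := A ^ 2) (b := V x ^ 2) (mem_Ici.2 (sq_nonneg _)) (mem_Ici.2 (sq_nonneg _))
      (pow_le_pow_left₀ hA (by linarith) 2)
    linarith
  · have := h.2.1.monotoneOn (a := V x ^ 2) (b := A ^ 2) (mem_Ici.2 (sq_nonneg _)) (mem_Ici.2 (sq_nonneg _))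
      (pow_le_pow_left₀ (hV x) (by linarith) 2)
    linarith
  · have := h.2.1.injOn (x₁ := V x ^ 2) (x₂ := A ^ 2) (mem_Ici.2 (sq_nonneg _)) (mem_Ici.2 (sq_nonneg _)) (by linarith)
    have := (pow_left_inj₀ (hV x) hA two_ne_zero).1 this
    linarith

theorem stmt_11 (Cg M Λ₁ Λ₂ : ℝ) (g₁ g₂ V₁ V₂ : ℝ → ℝ)
    (hCg : 0 < Cg) (hg₁ : GAss Cg g₁) (hg₂ : GAss Cg g₂)
    (hV₁ : ContDiff ℝ 2 V₁) (hV₂ : ContDiff ℝ 2 V₂)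
    (hb₁ : ∀ x : ℝ, 0 ≤ V₁ x ∧ V₁ x ≤ M) (hb₂ : ∀ x : ℝ, 0 ≤ V₂ x ∧ V₂ x ≤ M)
    (hΛ₁ : 0 ≤ Λ₁) (hΛ₂ : 0 ≤ Λ₂)
    (heq₁ : ∀ x : ℝ, -(deriv (deriv V₁) x) = (Λ₁ - g₁ ((V₂ x) ^ 2)) * V₁ x)
    (heq₂ : ∀ x : ℝ, -(deriv (deriv V₂) x) = (Λ₂ - g₂ ((V₁ x) ^ 2)) * V₂ x)
    (hfin₁ : FinitelyManyMonotonicityIntervals V₁)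
    (hfin₂ : FinitelyManyMonotonicityIntervals V₂) :
    ((∀ x : ℝ, V₁ x = 0) ∧ Λ₂ = 0) ∨
    ((∀ x : ℝ, V₂ x = 0) ∧ Λ₁ = 0) ∨
    ((∀ x : ℝ, V₁ x = 0) ∧ (∀ x : ℝ, V₂ x = 0)) ∨
    ((∀ x : ℝ, g₁ ((V₂ x) ^ 2) = Λ₁) ∧ (∀ x : ℝ, g₂ ((V₁ x) ^ 2) = Λ₂)) := by
  have dV : ∀ V : ℝ → ℝ, ContDiff ℝ 2 V → (∀ x, HasDerivAt V (deriv V x) x) ∧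
      ∀ x, HasDerivAt (deriv V) (deriv (deriv V) x) x := by
    intro V hV
    have h' : ContDiff ℝ 1 (deriv V) := by
      have : ContDiff ℝ (1 + 1) V := by simpa [one_add_one_eq_two] using hV
      exact (contDiff_succ_iff_deriv.1 this).2.2
    exact ⟨fun x => (hV.differentiable (by norm_num) x).hasDerivAt,
      fun x => (h'.differentiable (by norm_num) x).hasDerivAt⟩
  obtain ⟨p1, p2⟩ := dV V₁ hV₁
  obtain ⟨q1, q2⟩ := dV V₂ hV₂
  have e₁ : ∀ x, deriv (deriv V₁) x = (g₁ (V₂ x ^ 2) - Λ₁) * V₁ x :=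
    fun x => by linarith [heq₁ x]
  have e₂ : ∀ x, deriv (deriv V₂) x = (g₂ (V₁ x ^ 2) - Λ₂) * V₂ x :=
    fun x => by linarith [heq₂ x]
  have ab₁ : ∀ x, |V₁ x| ≤ M := fun x => by rw [abs_of_nonneg (hb₁ x).1]; exact (hb₁ x).2
  have ab₂ : ∀ x, |V₂ x| ≤ M := fun x => by rw [abs_of_nonneg (hb₂ x).1]; exact (hb₂ x).2
  obtain ⟨a, T, ta, hs⟩ := aux_evmono hb₁ hfin₁
  obtain ⟨b, -, tb, -⟩ := aux_evmono hb₂ hfin₂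
  have hM : 0 ≤ M := (hb₁ 0).1.trans (hb₁ 0).2
  have ha : 0 ≤ a := ge_of_tendsto ta (.of_forall fun x => (hb₁ x).1)
  have hb : 0 ≤ b := ge_of_tendsto tb (.of_forall fun x => (hb₂ x).1)
  have haM : a ≤ M := le_of_tendsto ta (.of_forall fun x => (hb₁ x).2)
  have hbM : b ≤ M := le_of_tendsto tb (.of_forall fun x => (hb₂ x).2)
  have G₁ := aux_glim hg₁ tb
  have G₂ := aux_glim hg₂ ta
  have l₁ : (g₁ (b ^ 2) - Λ₁) * a = 0 := by
    apply aux_lim p1 p2 ab₁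
    rw [funext e₁]
    exact (G₁.sub_const _).mul ta
  have l₂ : (g₂ (a ^ 2) - Λ₂) * b = 0 := by
    apply aux_lim q1 q2 ab₂
    rw [funext e₂]
    exact (G₂.sub_const _).mul tb
  have c₁ : Λ₁ = 0 → ∀ x, V₁ x = a := by
    intro h
    apply aux_const p1 p2 ab₁ _ ta
    intro x
    rw [e₁, h, sub_zero]
    exact mul_nonneg (aux_gpos hg₁ (sq_nonneg _)) (hb₁ x).1
  have c₂ : Λ₂ = 0 → ∀ x, V₂ x = b := by
    intro h
    apply aux_const q1 q2 ab₂ _ tb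
    intro x
    rw [e₂, h, sub_zero]
    exact mul_nonneg (aux_gpos hg₂ (sq_nonneg _)) (hb₂ x).1
  have K₀ : ∀ (g : ℝ → ℝ) (L x : ℝ), GAss Cg g → 0 ≤ L → 0 ≤ x → x ≤ M →
      |g (x ^ 2) - L| ≤ L + Cg * M ^ 2 := by
    intro g L x h hL hx hxM
    have h1 := aux_gpos h (sq_nonneg x)
    have h2 := (h.2.2 _ (sq_nonneg x)).2
    have h3 : Cg * x ^ 2 ≤ Cg * M ^ 2 := by gcongr
    rw [abs_le]
    constructor <;> nlinarith
  rcases ha.eq_or_lt with ha0 | hapos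
  · rcases hb.eq_or_lt with hb0 | hbpos
    · -- both limits vanish
      right; right; left
      rw [← ha0] at ta G₂
      rw [← hb0] at tb G₁
      rw [zero_pow two_ne_zero, aux_g0 hg₁] at G₁
      rw [zero_pow two_ne_zero, aux_g0 hg₂] at G₂
      have v₁ : (∃ S, ∀ x, S ≤ x → g₁ (V₂ x ^ 2) ≤ Λ₁) → ∀ x, V₁ x = 0 := by
        rintro ⟨S, hS⟩
        apply aux_vanish p1 p2 (T := S) (K := Λ₁ + Cg * M ^ 2) (by positivity) _
          (fun x => (hb₁ x).1) ta
        · intro x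
          rw [e₁, abs_mul]
          exact mul_le_mul_of_nonneg_right (K₀ _ _ _ hg₁ hΛ₁ (hb₂ x).1 (hb₂ x).2) (abs_nonneg _)
        · intro x hx
          rw [e₁]
          exact mul_nonpos_of_nonpos_of_nonneg (by linarith [hS x hx]) (hb₁ x).1
      have v₂ : (∃ S, ∀ x, S ≤ x → g₂ (V₁ x ^ 2) ≤ Λ₂) → ∀ x, V₂ x = 0 := by
        rintro ⟨S, hS⟩
        apply aux_vanish q1 q2 (T := S) (K := Λ₂ + Cg * M ^ 2) (by positivity) _
          (fun x => (hb₂ x).1) tb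
        · intro x
          rw [e₂, abs_mul]
          exact mul_le_mul_of_nonneg_right (K₀ _ _ _ hg₂ hΛ₂ (hb₁ x).1 (hb₁ x).2) (abs_nonneg _)
        · intro x hx
          rw [e₂]
          exact mul_nonpos_of_nonpos_of_nonneg (by linarith [hS x hx]) (hb₂ x).1
      have z₁ : Λ₁ = 0 → ∀ x, V₁ x = 0 := fun h x => by rw [c₁ h x, ha0]
      have z₂ : Λ₂ = 0 → ∀ x, V₂ x = 0 := fun h x => by rw [c₂ h x, hb0]
      have w₁ : ∀ x, V₁ x = 0 := by
        rcases hΛ₁.eq_or_lt with h | h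
        · exact z₁ h.symm
        · exact v₁ (eventually_atTop.1 (G₁.eventually_le_const h))
      refine ⟨w₁, ?_⟩
      rcases hΛ₂.eq_or_lt with h | h
      · exact z₂ h.symm
      · exact v₂ (eventually_atTop.1 (G₂.eventually_le_const h))
    · left
      have hL : Λ₂ = 0 := by
        rw [← ha0, zero_pow two_ne_zero, aux_g0 hg₂] at l₂
        rcases mul_eq_zero.1 l₂ with h | h <;> linarith
      refine ⟨?_, hL⟩
      have hc := c₂ hL
      have s := aux_sign hg₂ le_rfl (L := 0) (by simp [aux_g0 hg₂]) (fun x => (hb₁ x).1)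
      intro x
      have hf : V₂ = fun _ => b := funext hc
      have d0 : deriv (deriv V₂) x = 0 := by rw [hf]; simp
      rw [e₂, hL, hc x] at d0
      have := s.2.2 x ((mul_eq_zero.1 d0).resolve_right hbpos.ne')
      linarith
  · rcases hb.eq_or_lt with hb0 | hbpos
    · right; left
      have hL : Λ₁ = 0 := by
        rw [← hb0, zero_pow two_ne_zero, aux_g0 hg₁] at l₁
        rcases mul_eq_zero.1 l₁ with h | h <;> linarith
      refine ⟨?_, hL⟩
      have hc := c₁ hL
      have s := aux_sign hg₁ le_rfl (L := 0) (by simp [aux_g0 hg₁]) (fun x => (hb₂ x).1)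
      intro x
      have hf : V₁ = fun _ => a := funext hc
      have d0 : deriv (deriv V₁) x = 0 := by rw [hf]; simp
      rw [e₁, hL, hc x] at d0
      have := s.2.2 x ((mul_eq_zero.1 d0).resolve_right hapos.ne')
      linarith
    · right; right; right
      have L₁ : g₁ (b ^ 2) = Λ₁ := by
        linarith [(mul_eq_zero.1 l₁).resolve_right hapos.ne']
      have L₂ : g₂ (a ^ 2) = Λ₂ := by
        linarith [(mul_eq_zero.1 l₂).resolve_right hbpos.ne']
      obtain ⟨sp1, sn1, sz1⟩ := aux_sign hg₁ hb L₁ (fun x => (hb₂ x).1)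
      obtain ⟨sp2, sn2, sz2⟩ := aux_sign hg₂ ha L₂ (fun x => (hb₁ x).1)
      obtain ⟨k₁, hk₁, lip₁⟩ := aux_glip hg₁ M
      obtain ⟨k₂, hk₂, lip₂⟩ := aux_glip hg₂ M
      have main := aux_H (u := fun x => V₁ x - a) (w := fun x => V₂ x - b)
        (fun x => (p1 x).sub_const a) p2 (fun x => (q1 x).sub_const b) q2
        (K := (k₁ + k₂) * M) (T := T) (B := M) (by positivity)
        (by
          intro x
          have h1 := lip₁ _ _ (hb₂ x).1 (hb₂ x).2 hb hbM
          rw [L₁] at h1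
          rw [e₁, abs_mul]
          have h2 := mul_le_mul h1 (ab₁ x) (abs_nonneg _) (by positivity)
          refine h2.trans ?_
          have h3 : 0 ≤ k₂ * M * |V₂ x - b| := by positivity
          have h4 : 0 ≤ (k₁ + k₂) * M * |V₁ x - a| := by positivity
          linarith)
        (by
          intro x
          have h1 := lip₂ _ _ (hb₁ x).1 (hb₁ x).2 ha haM
          rw [L₂] at h1
          rw [e₂, abs_mul]
          have h2 := mul_le_mul h1 (ab₂ x) (abs_nonneg _) (by positivity)
          refine h2.trans ?_
          have h3 : 0 ≤ k₁ * M * |V₁ x - a| := by positivity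
          have h4 : 0 ≤ (k₁ + k₂) * M * |V₂ x - b| := by positivity
          linarith)
        (by
          intro x h0 h
          rw [e₁] at h
          exact sz1 x ((mul_eq_zero.1 h).resolve_right (by
            have : V₁ x = a := by linarith
            rw [this]; exact hapos.ne')))
        (by
          intro x h0 h
          rw [e₂] at h
          exact sz2 x ((mul_eq_zero.1 h).resolve_right (by
            have : V₂ x = b := by linarith
            rw [this]; exact hbpos.ne')))
        (fun x => abs_le.2 ⟨by linarith [(hb₁ x).1], by linarith [(hb₁ x).2]⟩)
        (fun x => abs_le.2 ⟨by linarith [(hb₂ x).1], by linarith [(hb₂ x).2]⟩)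
        (fun x h => by rw [e₁]; exact mul_nonneg (sp1 x h) (hb₁ x).1)
        (fun x h => by rw [e₂]; exact mul_nonneg (sp2 x h) (hb₂ x).1)
        (fun x h => by rw [e₁]; exact mul_nonpos_of_nonpos_of_nonneg (sn1 x h) (hb₁ x).1)
        (fun x h => by rw [e₂]; exact mul_nonpos_of_nonpos_of_nonneg (sn2 x h) (hb₂ x).1)
        (by simpa using ta.sub_const a) (by simpa using tb.sub_const b)
        (by simpa only [sub_nonpos, sub_nonneg] using hs)
      refine ⟨fun x => ?_, fun x => ?_⟩
      · have : V₂ x = b := by linarith [(main x).2]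
        rw [this, L₁]
      · have : V₁ x = a := by linarith [(main x).1]
        rw [this, L₂]
end

section
/- Let a < b, A, M > 0, and let u be continuous on [a,b], twice differentiable on (a,b), with −u''(x) ≤ −M u(x) and 0 ≤ u(x) ≤ A for all x ∈ (a,b). Then for every 0 < δ < (b−a)/2 one has u(x) ≤ 2A e^{−δ√M} for all x ∈ [a+δ, b−δ]. -/
open Set

theorem stmt_13 (a b A M : ℝ) (u : ℝ → ℝ)
    (hab : a < b) (hA : 0 < A) (hM : 0 < M)
    (hc : ContinuousOn u (Set.Icc a b))
    (hd₁ : ∀ x ∈ Set.Ioo a b, DifferentiableAt ℝ u x)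
    (hd₂ : ∀ x ∈ Set.Ioo a b, DifferentiableAt ℝ (deriv u) x)
    (hineq : ∀ x ∈ Set.Ioo a b, -(deriv (deriv u) x) ≤ -(M * u x))
    (hbound : ∀ x ∈ Set.Ioo a b, 0 ≤ u x ∧ u x ≤ A) :
    ∀ δ : ℝ, 0 < δ → δ < (b - a) / 2 →
      ∀ x ∈ Set.Icc (a + δ) (b - δ), u x ≤ 2 * A * Real.exp (-δ * Real.sqrt M) := by
  intro δ hδ _ x₀ hx₀
  obtain ⟨hl, hr⟩ := hx₀
  have hle : ∀ y ∈ Icc a b, u y ≤ A := by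
    intro y hy
    rw [← closure_Ioo hab.ne] at hy hc
    exact le_on_closure (fun z hz => (hbound z hz).2) hc continuousOn_const hy
  set s := Real.sqrt M with hs
  have hss : s * s = M := Real.mul_self_sqrt hM.le
  have hC : 0 < Real.cosh (s * δ) := Real.cosh_pos _
  set K := A / Real.cosh (s * δ) with hK
  have hKC : K * Real.cosh (s * δ) = A := by rw [hK]; field_simp
  set v : ℝ → ℝ := fun y => u y - K * Real.cosh (s * (y - x₀)) with hv
  have hlin : ∀ y, HasDerivAt (fun y : ℝ => s * (y - x₀)) s y := by
    intro y
    simpa using ((hasDerivAt_id y).sub_const x₀).const_mul s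
  have hv1 : ∀ y ∈ Ioo a b,
      HasDerivAt v (deriv u y - K * (Real.sinh (s * (y - x₀)) * s)) y := by
    intro y hy
    exact (hd₁ y hy).hasDerivAt.sub (((hlin y).cosh).const_mul K)
  have hv2 : ∀ y ∈ Ioo a b,
      deriv (deriv v) y = deriv (deriv u) y - K * (Real.cosh (s * (y - x₀)) * s * s) := by
    intro y hy
    have he : deriv v =ᶠ[nhds y] fun y => deriv u y - K * (Real.sinh (s * (y - x₀)) * s) := by
      filter_upwards [Ioo_mem_nhds hy.1 hy.2] with z hz
      exact (hv1 z hz).deriv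
    rw [he.deriv_eq]
    exact ((hd₂ y hy).hasDerivAt.sub ((((hlin y).sinh).mul_const s).const_mul K)).deriv
  have hsub : Icc (x₀ - δ) (x₀ + δ) ⊆ Icc a b := Icc_subset_Icc (by linarith) (by linarith)
  have hvc : ContinuousOn v (Icc (x₀ - δ) (x₀ + δ)) := by
    apply (hc.mono hsub).sub
    exact Continuous.continuousOn (by fun_prop)
  obtain ⟨m, hm, hmax⟩ := isCompact_Icc.exists_isMaxOn
    (nonempty_Icc.2 (by linarith : x₀ - δ ≤ x₀ + δ)) hvc
  have hvm : v m ≤ 0 := by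
    by_contra! hpos
    have hends : m ≠ x₀ - δ ∧ m ≠ x₀ + δ := by
      have h1 := hle m (hsub hm)
      constructor
      · rintro rfl
        have : v (x₀ - δ) = u (x₀ - δ) - A := by
          simp only [hv]
          rw [show s * (x₀ - δ - x₀) = -(s * δ) by ring, Real.cosh_neg, hKC]
        linarith
      · rintro rfl
        have : v (x₀ + δ) = u (x₀ + δ) - A := by
          simp only [hv]
          rw [show s * (x₀ + δ - x₀) = s * δ by ring, hKC]
        linarith
    have h1 : x₀ - δ < m := lt_of_le_of_ne hm.1 (Ne.symm hends.1)
    have h2 : m < x₀ + δ := lt_of_le_of_ne hm.2 hends.2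
    have hmI : m ∈ Ioo a b := ⟨by linarith, by linarith⟩
    have hlm : IsLocalMax v m := hmax.isLocalMax (Icc_mem_nhds h1 h2)
    have hvv : 0 < deriv (deriv v) m := by
      rw [hv2 m hmI]
      have h3 := hineq m hmI
      have h4 : 0 < M * v m := mul_pos hM hpos
      have h5 : M * v m = M * u m - K * (Real.cosh (s * (m - x₀)) * s * s) := by
        simp only [hv]; rw [← hss]; ring
      linarith
    have hmin : IsLocalMin v m :=
      isLocalMin_of_deriv_deriv_pos hvv hlm.deriv_eq_zero (hv1 m hmI).continuousAt
    have hconst : v =ᶠ[nhds m] fun _ => v m := by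
      filter_upwards [hlm, hmin] with z hz1 hz2
      exact le_antisymm hz1 hz2
    have : deriv (deriv v) m = 0 := by
      rw [hconst.deriv.deriv_eq]
      simp
    linarith
  have h0 : v x₀ ≤ v m := hmax (show x₀ ∈ Icc (x₀ - δ) (x₀ + δ) from ⟨by linarith, by linarith⟩)
  have h1 : u x₀ ≤ K := by
    have : v x₀ = u x₀ - K := by simp [hv]
    linarith
  refine h1.trans ?_
  rw [hK, div_le_iff₀ hC, Real.cosh_eq]
  have e1 : Real.exp (-δ * s) * Real.exp (s * δ) = 1 := by
    rw [← Real.exp_add]; simp [mul_comm]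
  have e2 : 0 < Real.exp (-δ * s) * Real.exp (-(s * δ)) := by positivity
  nlinarith
end
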